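/- arXiv:math/0608553 — 2 statements merged into one kernel-verified Lean document; each statement's English description precedes it below -/
import Mathlib

section
/- Let r, s ∈ (0,1) satisfy s = 2r(1−r) and r = 3s(1−s)² + 3s²(1−s). Then μ_r and μ_s are not homeomorphic: there is no homeomorphism h of the Cantor set Ω = {0,1}^ℕ with μ_s = μ_r ∘ h⁻¹. -/
open MeasureTheory Polynomial

/-- `P` is a partition polynomial: `P(X) = ∑_{i=0}^n a_i X^i (1-X)^(n-i)` with
integers `0 ≤ a_i ≤ C(n,i)`. -/
def IsPartitionPolynomial (P : Polynomial ℤ) : Prop :=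
  ∃ (n : ℕ) (a : ℕ → ℤ),
    (∀ i ≤ n, 0 ≤ a i ∧ a i ≤ (n.choose i : ℤ)) ∧
    P = ∑ i ∈ Finset.range (n + 1), C (a i) * X ^ i * (1 - X) ^ (n - i)

/-- `μ` is the Bernoulli(`r`) product measure on the Cantor set `ℕ → Bool`:
every cylinder specifying the coordinates in a finite set `s` to agree with `e`
has measure `r^(#1s) * (1-r)^(#0s)`.  (This characterizes the infinite power of
the `(r, 1-r)` measure on `{0,1}` uniquely among Borel measures.) -/
def IsBernoulli (r : ℝ) (μ : Measure (ℕ → Bool)) : Prop :=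
  ∀ (s : Finset ℕ) (e : ℕ → Bool),
    μ {x : ℕ → Bool | ∀ i ∈ s, x i = e i} =
      ENNReal.ofReal (r ^ (s.filter fun i => e i = true).card *
        (1 - r) ^ (s.filter fun i => e i = false).card)

/-- The point of the Cantor set with set of ones equal to `A`. -/
def chi (A : Finset ℕ) : ℕ → Bool := fun i => decide (i ∈ A)

open Classical in
/-- The polynomial giving the measure of a set determined by the first `N` coordinates. -/
noncomputable def clopenPoly (U : Set (ℕ → Bool)) (N : ℕ) : Polynomial ℤ :=
  ∑ A ∈ (Finset.range N).powerset.filter (fun A => chi A ∈ U), X ^ A.card * (1 - X) ^ (N - A.card)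

theorem exists_det (U : Set (ℕ → Bool)) (hU : IsClopen U) :
    ∃ N : ℕ, ∀ x y : ℕ → Bool, (∀ i < N, x i = y i) → (x ∈ U ↔ y ∈ U) := by
  have key : ∃ N : ℕ, ∀ x ∈ (Set.univ : Set (ℕ → Bool)), ∀ y : ℕ → Bool,
      (∀ i < N, x i = y i) → (x ∈ U ↔ y ∈ U) := by
    refine isCompact_univ.induction_on (p := fun s => ∃ N : ℕ, ∀ x ∈ s, ∀ y : ℕ → Bool,
      (∀ i < N, x i = y i) → (x ∈ U ↔ y ∈ U)) ?_ ?_ ?_ ?_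
    · exact ⟨0, by simp⟩
    · rintro s t hst ⟨N, hN⟩
      exact ⟨N, fun x hx => hN x (hst hx)⟩
    · rintro s t ⟨N, hN⟩ ⟨M, hM⟩
      refine ⟨max N M, ?_⟩
      rintro x (hx | hx) y hy
      · exact hN x hx y fun i hi => hy i (lt_of_lt_of_le hi (le_max_left _ _))
      · exact hM x hx y fun i hi => hy i (lt_of_lt_of_le hi (le_max_right _ _))
    · intro x _
      have aux : ∀ V : Set (ℕ → Bool), IsOpen V → x ∈ V →
          ∃ n, PiNat.cylinder x n ⊆ V := by
        intro V hV hx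
        obtain ⟨W, ⟨z, n, rfl⟩, hxW, hWV⟩ :=
          (PiNat.isTopologicalBasis_cylinders (fun _ : ℕ => Bool)).exists_subset_of_mem_open hx hV
        exact ⟨n, by rwa [PiNat.mem_cylinder_iff_eq.1 hxW]⟩
      have hloc : ∃ n, ∀ y ∈ PiNat.cylinder x n, (x ∈ U ↔ y ∈ U) := by
        by_cases hx : x ∈ U
        · obtain ⟨n, hn⟩ := aux U hU.isOpen hx
          exact ⟨n, fun y hy => ⟨fun _ => hn hy, fun _ => hx⟩⟩
        · obtain ⟨n, hn⟩ := aux Uᶜ hU.compl.isOpen hx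
          exact ⟨n, fun y hy => ⟨fun h => absurd h hx, fun h => absurd h (hn hy)⟩⟩
      obtain ⟨n, hn⟩ := hloc
      refine ⟨PiNat.cylinder x n, mem_nhdsWithin_of_mem_nhds
        ((PiNat.isOpen_cylinder (fun _ : ℕ => Bool) x n).mem_nhds (PiNat.self_mem_cylinder x n)), n, ?_⟩
      intro y hy z hz
      rw [← hn y hy, ← hn z]
      intro i hi
      rw [← hz i hi]
      exact hy i hi
  obtain ⟨N, hN⟩ := key
  exact ⟨N, fun x y => hN x (Set.mem_univ _) y⟩

theorem measure_eq_poly (t : ℝ) (ht : t ∈ Set.Ioo (0 : ℝ) 1) (μ : Measure (ℕ → Bool))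
    (hμ : IsBernoulli t μ) (U : Set (ℕ → Bool)) (N : ℕ)
    (hN : ∀ x y : ℕ → Bool, (∀ i < N, x i = y i) → (x ∈ U ↔ y ∈ U)) :
    μ U = ENNReal.ofReal (aeval t (clopenPoly U N)) ∧ 0 ≤ aeval t (clopenPoly U N) := by
  classical
  have h0 : 0 ≤ t := ht.1.le
  have h1 : 0 ≤ 1 - t := by linarith [ht.2]
  have ev : aeval t (clopenPoly U N) =
      ∑ A ∈ (Finset.range N).powerset.filter (fun A => chi A ∈ U),
        t ^ A.card * (1 - t) ^ (N - A.card) := by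
    simp [clopenPoly]
  refine ⟨?_, by rw [ev]; positivity⟩
  have hUeq : U = ⋃ A ∈ (Finset.range N).powerset.filter (fun A => chi A ∈ U),
      {x : ℕ → Bool | ∀ i ∈ Finset.range N, x i = chi A i} := by
    ext x
    simp only [Set.mem_iUnion, Finset.mem_filter, Finset.mem_powerset, Set.mem_ofPred_eq,
      Finset.mem_range, exists_prop]
    constructor
    · intro hx
      have hag : ∀ i < N, x i = chi ((Finset.range N).filter (fun i => x i = true)) i := by
        intro i hi
        simp [chi, hi]
      exact ⟨_, ⟨Finset.filter_subset _ _, (hN _ _ hag).1 hx⟩, hag⟩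
    · rintro ⟨A, ⟨_, hA⟩, hx⟩
      exact (hN _ _ hx).2 hA
  rw [ev, ENNReal.ofReal_sum_of_nonneg (by intros; positivity)]
  conv_lhs => rw [hUeq]
  rw [measure_biUnion_finset]
  · refine Finset.sum_congr rfl fun A hA => ?_
    rw [hμ]
    have hA' : A ⊆ Finset.range N := by
      simpa using (Finset.mem_filter.1 hA).1
    have e1 : (Finset.range N).filter (fun i => chi A i = true) = A := by
      ext i
      simp only [chi, Finset.mem_filter, decide_eq_true_eq]
      exact ⟨fun h => h.2, fun h => ⟨hA' h, h⟩⟩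
    have e2 : (Finset.range N).filter (fun i => chi A i = false) = Finset.range N \ A := by
      ext i
      simp [chi]
    rw [e1, e2, Finset.card_sdiff_of_subset hA', Finset.card_range]
  · intro A hA B hB hAB
    rw [Function.onFun, Set.disjoint_left]
    intro x hxA hxB
    apply hAB
    have hA' : A ⊆ Finset.range N := by simpa using (Finset.mem_filter.1 hA).1
    have hB' : B ⊆ Finset.range N := by simpa using (Finset.mem_filter.1 hB).1
    have hag : ∀ i ∈ Finset.range N, (i ∈ A ↔ i ∈ B) := by
      intro i hi
      have := (hxA i hi).symm.trans (hxB i hi)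
      simpa [chi] using this
    ext i
    exact ⟨fun h => (hag i (hA' h)).1 h, fun h => (hag i (hB' h)).2 h⟩
  · intro A _
    have : {x : ℕ → Bool | ∀ i ∈ Finset.range N, x i = chi A i} =
        ⋂ i ∈ Finset.range N, (fun x : ℕ → Bool => x i) ⁻¹' {chi A i} := by
      ext x; simp
    rw [this]
    exact Finset.measurableSet_biInter _ fun i _ => measurable_pi_apply i (measurableSet_singleton _)

open Classical in
theorem coeff_zero_poly (U : Set (ℕ → Bool)) (N : ℕ) :
    (clopenPoly U N).coeff 0 = if chi ∅ ∈ U then 1 else 0 := by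
  have hterm : ∀ A : Finset ℕ, ((X : Polynomial ℤ) ^ A.card * (1 - X) ^ (N - A.card)).coeff 0 =
      if A = ∅ then 1 else 0 := by
    intro A
    simp only [coeff_zero_eq_eval_zero, eval_mul, eval_pow, eval_X, eval_sub, eval_one, sub_zero,
      one_pow, mul_one]
    by_cases hA : A = ∅
    · simp [hA]
    · simp [hA]
  rw [clopenPoly, finsetSum_coeff]
  simp only [hterm]
  rw [Finset.sum_ite_eq']
  simp

open Classical in
theorem coeff_one_poly (U : Set (ℕ → Bool)) (N k : ℕ) (hk : k < N)
    (hU : ∀ x ∈ U, x k = true) :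
    (clopenPoly U N).coeff 1 = if chi {k} ∈ U then 1 else 0 := by
  rw [clopenPoly, finsetSum_coeff]
  have hterm : ∀ A ∈ (Finset.range N).powerset.filter (fun A => chi A ∈ U),
      ((X : Polynomial ℤ) ^ A.card * (1 - X) ^ (N - A.card)).coeff 1 =
      if A = {k} then 1 else 0 := by
    intro A hA
    have hkA : k ∈ A := by
      have := hU _ (Finset.mem_filter.1 hA).2
      simpa [chi] using this
    rw [coeff_X_pow_mul']
    have hpos : 0 < A.card := Finset.card_pos.2 ⟨k, hkA⟩
    by_cases h1 : A = {k}
    · subst h1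
      simp [coeff_zero_eq_eval_zero]
    · rw [if_neg h1, if_neg]
      intro hle
      apply h1
      obtain ⟨a, ha⟩ := Finset.card_eq_one.1 (le_antisymm hle hpos)
      subst ha
      simpa using (Finset.mem_singleton.1 hkA).symm
  rw [Finset.sum_congr rfl hterm, Finset.sum_ite_eq']
  simp [hk]

/-- The minimal polynomial of `r` (up to a constant). -/
noncomputable def pp : Polynomial ℤ := C 12 * X ^ 3 + C (-24) * X ^ 2 + C 18 * X + C (-5)

theorem pp_natDegree : pp.natDegree = 3 := natDegree_cubic (by norm_num)

theorem pp_coeffs : pp.coeff 0 = -5 ∧ pp.coeff 1 = 18 ∧ pp.coeff 2 = -24 ∧ pp.coeff 3 = 12 := by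
  refine ⟨?_, ?_, ?_, ?_⟩ <;> simp [pp, coeff_X, coeff_C]

theorem pp_primitive : pp.IsPrimitive := by
  rw [isPrimitive_iff_isUnit_of_C_dvd]
  intro a ha
  rw [C_dvd_iff_dvd_coeff] at ha
  obtain ⟨c0, c1, c2, c3⟩ := pp_coeffs
  have d0 := ha 0
  have d3 := ha 3
  rw [c0] at d0
  rw [c3] at d3
  have : a ∣ 1 := by
    have := dvd_add (d0.mul_left (-5)) (d3.mul_left (-2))
    norm_num at this
    exact this
  exact isUnit_of_dvd_one this

theorem no_rat_root (x : ℚ) : 12 * x ^ 3 - 24 * x ^ 2 + 18 * x - 5 ≠ 0 := by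
  intro hx
  have hIntg : IsIntegral ℤ (6 * x) := by
    refine ⟨X ^ 3 + (C (-12) * X ^ 2 + C 54 * X + C (-90)), ?_, ?_⟩
    · apply monic_X_pow_add
      exact lt_of_le_of_lt degree_quadratic_le (by norm_num)
    · simp
      linear_combination 18 * hx
  obtain ⟨y, hy⟩ := IsIntegrallyClosed.isIntegral_iff.1 hIntg
  have hy' : (y : ℚ) = 6 * x := by simpa using hy
  have hq : (y : ℚ) ^ 3 - 12 * y ^ 2 + 54 * y - 90 = 0 := by
    rw [hy']; linear_combination 18 * hx
  have hz : y ^ 3 - 12 * y ^ 2 + 54 * y - 90 = 0 := by exact_mod_cast hq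
  obtain ⟨z, rfl | rfl⟩ := Int.even_or_odd' y
  · have : 4 * (2 * z ^ 3 - 12 * z ^ 2 + 27 * z) = 90 := by linear_combination hz
    omega
  · have : 2 * (4 * z ^ 3 - 18 * z ^ 2 + 33 * z) = 47 := by linear_combination hz
    omega

theorem pp_irreducible : Irreducible (pp.map (Int.castRingHom ℚ)) := by
  apply irreducible_of_degree_le_three_of_not_isRoot
  · rw [natDegree_map_eq_of_injective (RingHom.injective_int _), pp_natDegree]
    simp
  · intro x hx
    apply no_rat_root x
    simp [IsRoot, pp] at hx
    linear_combination hx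

theorem pp_dvd (r : ℝ) (hr : aeval r pp = 0) (P : Polynomial ℤ) (hP : aeval r P = 0) :
    pp ∣ P := by
  rw [IsPrimitive.Int.dvd_iff_map_cast_dvd_map_cast _ _ pp_primitive]
  have e : ∀ Q : Polynomial ℤ, aeval r (Q.map (Int.castRingHom ℚ)) = aeval r Q := fun Q =>
    aeval_map_algebraMap ℚ r Q
  have hd : minpoly ℚ r ∣ pp.map (Int.castRingHom ℚ) := minpoly.dvd _ _ (by rw [e, hr])
  have hIntg : ¬ IsUnit (minpoly ℚ r) := minpoly.not_isUnit ℚ r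
  have hass := (pp_irreducible.dvd_iff.1 hd).resolve_left hIntg
  exact hass.dvd.trans (minpoly.dvd _ _ (by rw [e, hP]))

theorem key_arith (r s : ℝ) (hr : aeval r pp = 0) (h1 : s = 2 * r * (1 - r))
    (P Q : Polynomial ℤ) (h : aeval r P = aeval s Q) :
    (5 : ℤ) ∣ P.coeff 0 - Q.coeff 0 ∧
      (P.coeff 0 = 0 → Q.coeff 0 = 0 → (5 : ℤ) ∣ P.coeff 1 - 2 * Q.coeff 1) := by
  have hz : aeval r (P - Q.comp (2 * X * (1 - X))) = 0 := by
    rw [map_sub, aeval_comp]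
    simp only [map_mul, map_sub, map_one, aeval_X, map_ofNat]
    rw [← h1, h, sub_self]
  obtain ⟨R, hR⟩ := pp_dvd r hr _ hz
  obtain ⟨c0, c1, -, -⟩ := pp_coeffs
  have q0 : (Q.comp (2 * X * (1 - X))).coeff 0 = Q.coeff 0 := by
    simp [coeff_zero_eq_eval_zero]
  have q1 : (Q.comp (2 * X * (1 - X))).coeff 1 = 2 * Q.coeff 1 := by
    have hd : ∀ F : Polynomial ℤ, F.coeff 1 = F.derivative.eval 0 := by
      intro F
      rw [← coeff_zero_eq_eval_zero, coeff_derivative]; simp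
    rw [hd, hd, derivative_comp]
    simp
  have e0 := congrArg (fun F => coeff F 0) hR
  have e1 := congrArg (fun F => coeff F 1) hR
  simp only [coeff_sub, q0, q1, mul_coeff_zero, mul_coeff_one, c0, c1] at e0 e1
  refine ⟨⟨-R.coeff 0, by linarith⟩, fun hp hq => ⟨- R.coeff 1, ?_⟩⟩
  have : R.coeff 0 = 0 := by rw [hp, hq] at e0; omega
  rw [e1, this]; ring

/-- for `r, s ∈ (0,1)` with `s = 2r(1-r)` and
`r = 3s(1-s)² + 3s²(1-s)`, the measures `μ_r` and `μ_s` are not homeomorphic. -/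
theorem mu_r_mu_s_not_homeomorphic (r s : ℝ)
    (hr : r ∈ Set.Ioo (0 : ℝ) 1) (hs : s ∈ Set.Ioo (0 : ℝ) 1)
    (h1 : s = 2 * r * (1 - r)) (h2 : r = 3 * s * (1 - s) ^ 2 + 3 * s ^ 2 * (1 - s))
    (μ ν : Measure (ℕ → Bool)) (hμ : IsBernoulli r μ) (hν : IsBernoulli s ν) :
    ¬ ∃ h : (ℕ → Bool) ≃ₜ (ℕ → Bool), ν = μ.map h := by
  classical
  rintro ⟨h, hh⟩
  have hroot : aeval r pp = 0 := by
    have e : r * (12 * r ^ 3 - 24 * r ^ 2 + 18 * r - 5) = 0 := by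
      rw [h1] at h2
      linear_combination h2
    have e' := (mul_eq_zero.1 e).resolve_left hr.1.ne'
    simp only [pp, map_add, map_mul, map_pow, map_neg, map_ofNat, aeval_X]
    linarith
  -- the basic comparison
  have cmp : ∀ V : Set (ℕ → Bool), IsClopen V → ∀ K : ℕ, ∃ N M : ℕ, K < N ∧ K < M ∧
      aeval r (clopenPoly (h ⁻¹' V) N) = aeval s (clopenPoly V M) := by
    intro V hV K
    have hU : IsClopen (h ⁻¹' V) := hV.preimage h.continuous
    obtain ⟨N, hN⟩ := exists_det _ hU
    obtain ⟨M, hM⟩ := exists_det _ hV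
    refine ⟨N + K + 1, M + K + 1, by omega, by omega, ?_⟩
    obtain ⟨a1, a2⟩ := measure_eq_poly r hr μ hμ (h ⁻¹' V) (N + K + 1)
      (fun x y hxy => hN x y fun i hi => hxy i (by omega))
    obtain ⟨b1, b2⟩ := measure_eq_poly s hs ν hν V (M + K + 1)
      (fun x y hxy => hM x y fun i hi => hxy i (by omega))
    rw [hh, Measure.map_apply h.continuous.measurable hV.isOpen.measurableSet, a1] at b1
    exact (ENNReal.ofReal_eq_ofReal_iff a2 b2).1 b1
  have hcyl : ∀ k : ℕ, IsClopen {x : ℕ → Bool | x k = true} := fun k =>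
    (isClopen_discrete {true}).preimage (continuous_apply k)
  have hne : ∀ x : ℕ → Bool, x ≠ chi ∅ → ∃ k, x k = true := by
    intro x hx
    by_contra! hc
    apply hx
    funext k
    simpa [chi] using hc k
  -- `h` fixes the zero point
  have hfix : h (chi ∅) = chi ∅ := by
    by_contra hx
    obtain ⟨k, hk⟩ := hne _ hx
    obtain ⟨N, M, _, _, e⟩ := cmp _ (hcyl k) 0
    have := (key_arith r s hroot h1 _ _ e).1
    rw [coeff_zero_poly, coeff_zero_poly, if_pos (show chi ∅ ∈ h ⁻¹' {x : ℕ → Bool | x k = true} from hk),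
      if_neg (by simp [chi])] at this
    norm_num at this
  have hne1 : h (chi {0}) ≠ chi ∅ := by
    intro hx
    have := h.injective (hx.trans hfix.symm)
    have := congrFun this 0
    simp [chi] at this
  obtain ⟨k, hk⟩ := hne _ hne1
  let V : Set (ℕ → Bool) := {x | x k = true} ∩ h.symm ⁻¹' {x | x 0 = true}
  have hV : IsClopen V := (hcyl k).inter ((hcyl 0).preimage h.symm.continuous)
  obtain ⟨N, M, hN, hM, e⟩ := cmp V hV k
  obtain ⟨-, d⟩ := key_arith r s hroot h1 _ _ e
  have m0 : chi ∅ ∉ V := fun hx => by simpa [chi] using hx.1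
  have m0' : chi ∅ ∉ h ⁻¹' V := by
    rw [Set.mem_preimage, hfix]; exact m0
  have m1 : chi {0} ∈ h ⁻¹' V := ⟨hk, by simp [chi]⟩
  have d' := d (by rw [coeff_zero_poly, if_neg m0']) (by rw [coeff_zero_poly, if_neg m0])
  rw [coeff_one_poly _ N 0 (by omega) (fun x hx => by simpa using hx.2),
    coeff_one_poly _ M k hM (fun x hx => hx.1), if_pos m1] at d'
  split_ifs at d' <;> norm_num at d'
end

section
/- There exist r, s ∈ [0,1] that are binomially equivalent (each is the value at the other of some partition polynomial) and yet the measures μ_r and μ_s are not homeomorphic: no homeomorphism h of the Cantor set Ω = {0,1}^ℕ satisfies μ_s = μ_r ∘ h⁻¹. In particular, it is not true that μ_r and μ_s are homeomorphic whenever each is a continuous image of the other. -/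
open MeasureTheory Polynomial

namespace BernoulliAux

/-- one-coordinate Bernoulli measure -/
noncomputable def bern (t : ℝ) : Measure Bool :=
  ENNReal.ofReal t • Measure.dirac true + ENNReal.ofReal (1 - t) • Measure.dirac false

lemma bern_true (t : ℝ) : bern t {true} = ENNReal.ofReal t := by simp [bern]
lemma bern_false (t : ℝ) : bern t {false} = ENNReal.ofReal (1 - t) := by simp [bern]

lemma bern_prob {t : ℝ} (h0 : 0 ≤ t) (h1 : t ≤ 1) : IsProbabilityMeasure (bern t) := by
  constructor
  simp only [bern, Measure.coe_add, Measure.coe_smul, Pi.add_apply, Pi.smul_apply, measure_univ,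
    smul_eq_mul, mul_one]
  rw [← ENNReal.ofReal_add h0 (by linarith)]
  simp

/-- cylinder set -/
def cyl (s : Finset ℕ) (e : ℕ → Bool) : Set (ℕ → Bool) := {x | ∀ i ∈ s, x i = e i}

lemma isClopen_cyl (s : Finset ℕ) (e : ℕ → Bool) : IsClopen (cyl s e) := by
  have : cyl s e = ⋂ i ∈ s, (fun x : ℕ → Bool => x i) ⁻¹' {e i} := by
    ext x; simp [cyl]
  rw [this]
  refine isClopen_biInter_finset fun i _ => ?_
  exact (isClopen_discrete _).preimage (continuous_apply i)

lemma eq_infinitePi_of_isBernoulli {t : ℝ} (h0 : 0 ≤ t) (h1 : t ≤ 1)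
    [IsProbabilityMeasure (bern t)] {μ : Measure (ℕ → Bool)} (h : IsBernoulli t μ) :
    μ = Measure.infinitePi (fun _ : ℕ => bern t) := by
  have huniv : μ Set.univ = 1 := by
    have := h ∅ (fun _ => true)
    simpa using this
  have : IsProbabilityMeasure μ := ⟨huniv⟩
  refine ext_of_generate_finite ({S | ∃ s e, S = cyl s e} ∪ {∅}) ?_ ?_ ?_ ?_
  · apply le_antisymm
    · refine iSup_le fun i => ?_
      rw [← measurable_iff_comap_le]
      refine @measurable_to_bool _ (MeasurableSpace.generateFrom _) _ ?_
      apply MeasurableSpace.measurableSet_generateFrom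
      left
      refine ⟨{i}, fun _ => true, ?_⟩
      ext x; simp [cyl]
    · apply MeasurableSpace.generateFrom_le
      rintro S (⟨s, e, rfl⟩ | rfl)
      · exact (isClopen_cyl s e).isOpen.measurableSet
      · exact MeasurableSet.empty
  · rintro S (⟨s, e, rfl⟩ | rfl) T (⟨s', e', rfl⟩ | rfl) hne
    · left
      obtain ⟨z, hz, hz'⟩ := hne
      refine ⟨s ∪ s', z, ?_⟩
      ext x
      simp only [cyl, Set.mem_inter_iff, Set.mem_ofPred_eq, Finset.mem_union] at *
      constructor
      · rintro ⟨a, b⟩ i (hi | hi)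
        · rw [a i hi, hz i hi]
        · rw [b i hi, hz' i hi]
      · intro a
        exact ⟨fun i hi => by rw [a i (Or.inl hi), hz i hi],
          fun i hi => by rw [a i (Or.inr hi), hz' i hi]⟩
    · simp at hne
    · simp at hne
    · simp at hne
  · rintro S (⟨s, e, rfl⟩ | rfl)
    · have h2 : cyl s e = Set.pi (s : Set ℕ) (fun i => {e i}) := by
        ext x; simp [cyl, Set.mem_pi]
      have h3 := h s e
      change μ (cyl s e) = _ at h3
      rw [h3, h2, Measure.infinitePi_pi _ (by measurability)]
      have h4 : ∀ i ∈ s, bern t {e i} = ENNReal.ofReal (if e i = true then t else 1 - t) := by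
        intro i _
        cases e i <;> simp [bern_true, bern_false]
      rw [Finset.prod_congr rfl h4, ← ENNReal.ofReal_prod_of_nonneg]
      · rw [Finset.prod_ite]
        simp
      · intro i _; split_ifs <;> linarith
    · simp
  · rw [huniv]; simp

/-- block code -/
def blockMap (n : ℕ) (F : (Fin n → Bool) → Bool) (x : ℕ → Bool) : ℕ → Bool :=
  fun i => F (fun j => x (i * n + j))

lemma continuous_blockMap (n : ℕ) (F : (Fin n → Bool) → Bool) : Continuous (blockMap n F) := by
  refine continuous_pi fun i => ?_
  exact continuous_of_discreteTopology.comp (continuous_pi fun j => continuous_apply _)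

lemma map_blockMap {t t' : ℝ} [IsProbabilityMeasure (bern t)] [IsProbabilityMeasure (bern t')]
    (n : ℕ) [NeZero n] (F : (Fin n → Bool) → Bool)
    (hF : (Measure.infinitePi (fun _ : Fin n => bern t)).map F = bern t') :
    (Measure.infinitePi (fun _ : ℕ => bern t)).map (blockMap n F) =
      Measure.infinitePi (fun _ : ℕ => bern t') := by
  have hm : Measurable F := measurable_of_countable F
  have e1 := Measure.map_infinitePi_infinitePi_of_inj (P := fun _ : ℕ => bern t)
    (Nat.divModEquiv n).symm.injective
  have e2 := Measure.infinitePi_map_curry (fun (_ : ℕ) (_ : Fin n) => bern t)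
  have e3 := Measure.infinitePi_map_pi
    (μ := fun _ : ℕ => Measure.infinitePi (fun _ : Fin n => bern t)) (f := fun _ => F)
    (fun _ => hm)
  rw [hF] at e3
  rw [← e3, ← e2, ← e1, Measure.map_map, Measure.map_map]
  · congr 1
  · fun_prop
  · fun_prop
  · fun_prop
  · fun_prop

lemma map_word {t t' : ℝ} (h0 : 0 ≤ t) (h1 : t ≤ 1)
    [IsProbabilityMeasure (bern t)] [IsProbabilityMeasure (bern t')]
    (n : ℕ) (F : (Fin n → Bool) → Bool)
    (hF : ∑ w : Fin n → Bool, (if F w = true then ∏ i, (if w i = true then t else 1 - t) else 0)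
      = t') :
    (Measure.infinitePi (fun _ : Fin n => bern t)).map F = bern t' := by
  have hm : Measurable F := measurable_of_countable F
  have := Measure.isProbabilityMeasure_map
    (μ := Measure.infinitePi (fun _ : Fin n => bern t)) hm.aemeasurable
  have key : ((Measure.infinitePi (fun _ : Fin n => bern t)).map F) {true} = bern t' {true} := by
    rw [Measure.map_apply hm (measurableSet_singleton _), bern_true, Measure.infinitePi_eq_pi,
      ← hF, ← Finset.sum_filter]
    have : F ⁻¹' {true} = ((Finset.univ.filter fun w => F w = true : Finset (Fin n → Bool)) :
        Set (Fin n → Bool)) := by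
      ext w; simp
    rw [this, ← sum_measure_singleton, ENNReal.ofReal_sum_of_nonneg]
    · refine Finset.sum_congr rfl fun w _ => ?_
      rw [Measure.pi_singleton, ENNReal.ofReal_prod_of_nonneg]
      · refine Finset.prod_congr rfl fun i _ => ?_
        cases w i <;> simp [bern_true, bern_false]
      · intro i _; split_ifs <;> linarith
    · intro w _
      exact Finset.prod_nonneg fun i _ => by split_ifs <;> linarith
  have hc : ({false} : Set Bool) = {true}ᶜ := by ext b; cases b <;> simp
  refine Measure.ext_of_singleton fun b => ?_
  cases b
  · rw [hc, prob_compl_eq_one_sub (measurableSet_singleton _),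
      prob_compl_eq_one_sub (measurableSet_singleton _), key]
  · exact key

lemma exists_map {t t' : ℝ} (h0 : 0 ≤ t) (h1 : t ≤ 1) (h0' : 0 ≤ t') (h1' : t' ≤ 1)
    (n : ℕ) [NeZero n] (F : (Fin n → Bool) → Bool)
    (hF : ∑ w : Fin n → Bool, (if F w = true then ∏ i, (if w i = true then t else 1 - t) else 0)
      = t') {μ ν : Measure (ℕ → Bool)} (hμ : IsBernoulli t μ) (hν : IsBernoulli t' ν) :
    ∃ f : (ℕ → Bool) → (ℕ → Bool), Continuous f ∧ ν = μ.map f := by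
  have := bern_prob h0 h1
  have := bern_prob h0' h1'
  refine ⟨blockMap n F, continuous_blockMap n F, ?_⟩
  rw [eq_infinitePi_of_isBernoulli h0 h1 hμ, eq_infinitePi_of_isBernoulli h0' h1' hν,
    map_blockMap n F (map_word h0 h1 n F hF)]

/-- value of a clopen set -/
lemma clopen_value {t : ℝ} (h0 : 0 ≤ t) (h1 : t ≤ 1) {ν : Measure (ℕ → Bool)}
    (hν : IsBernoulli t ν) {V : Set (ℕ → Bool)} (hV : IsClopen V) :
    ∃ (M : ℕ) (T : Finset (Finset ℕ)) (l : Finset ℕ → ℕ),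
      (∀ A, A ∈ T ↔ A ⊆ Finset.range M ∧ (fun i => decide (i ∈ A)) ∈ V) ∧
      ν V = ENNReal.ofReal (∑ A ∈ T, t ^ A.card * (1 - t) ^ l A) := by
  classical
  have loc : ∀ x : ℕ → Bool, ∃ n, ∀ y ∈ cyl (Finset.range n) x, (y ∈ V ↔ x ∈ V) := by
    have aux : ∀ U : Set (ℕ → Bool), IsOpen U → ∀ x ∈ U, ∃ n, cyl (Finset.range n) x ⊆ U := by
      intro U hU x hx
      obtain ⟨I, u, hu, hsub⟩ := isOpen_pi_iff.1 hU x hx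
      refine ⟨I.sup id + 1, fun y hy => hsub fun i hi => ?_⟩
      have : i ∈ Finset.range (I.sup id + 1) := by
        have := Finset.le_sup (f := id) hi
        simp at this ⊢; omega
      rw [hy i this]
      exact (hu i hi).2
    intro x
    by_cases hx : x ∈ V
    · obtain ⟨n, hn⟩ := aux V hV.isOpen x hx
      exact ⟨n, fun y hy => iff_of_true (hn hy) hx⟩
    · obtain ⟨n, hn⟩ := aux Vᶜ hV.compl.isOpen x hx
      exact ⟨n, fun y hy => iff_of_false (hn hy) hx⟩
  choose n hn using loc
  obtain ⟨t', ht'⟩ := CompactSpace.elim_nhds_subcover (fun x => cyl (Finset.range (n x)) x)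
    (fun x => (isClopen_cyl _ _).isOpen.mem_nhds (fun i _ => rfl))
  have unif : ∀ x y : ℕ → Bool, (∀ i < t'.sup n, y i = x i) → (x ∈ V ↔ y ∈ V) := by
    intro x y hxy
    have hx : x ∈ ⋃ z ∈ t', cyl (Finset.range (n z)) z := by rw [ht']; trivial
    simp only [Set.mem_iUnion] at hx
    obtain ⟨z, hz, hxz⟩ := hx
    have hle : n z ≤ t'.sup n := Finset.le_sup hz
    have hyz : y ∈ cyl (Finset.range (n z)) z := fun i hi => by
      rw [hxy i (lt_of_lt_of_le (Finset.mem_range.1 hi) hle), hxz i hi]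
    rw [hn z x hxz, hn z y hyz]
  set M := t'.sup n
  let ind : Finset ℕ → ℕ → Bool := fun A i => decide (i ∈ A)
  let T : Finset (Finset ℕ) := (Finset.range M).powerset.filter fun A => ind A ∈ V
  refine ⟨M, T, fun A => ((Finset.range M).filter fun i => ind A i = false).card, ?_, ?_⟩
  · intro A; simp [T, ind]
  have hVu : V = ⋃ A ∈ T, cyl (Finset.range M) (ind A) := by
    ext x
    simp only [Set.mem_iUnion, exists_prop]
    constructor
    · intro hx
      have hagree : ∀ i < M, x i = ind ((Finset.range M).filter fun i => x i = true) i := by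
        intro i hi
        simp [ind, hi]
      refine ⟨(Finset.range M).filter fun i => x i = true, ?_,
        fun i hi => hagree i (Finset.mem_range.1 hi)⟩
      simp only [T, Finset.mem_filter, Finset.mem_powerset, Finset.filter_subset, true_and]
      exact (unif _ _ hagree).2 hx
    · rintro ⟨A, hA, hx⟩
      have := (Finset.mem_filter.1 hA).2
      exact (unif _ _ fun i hi => hx i (Finset.mem_range.2 hi)).1 this
  rw [hVu, measure_biUnion_finset]
  · rw [ENNReal.ofReal_sum_of_nonneg]
    · refine Finset.sum_congr rfl fun A hA => ?_
      have h3 := hν (Finset.range M) (ind A)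
      change ν (cyl _ _) = _ at h3
      rw [h3]
      have : (Finset.range M).filter (fun i => ind A i = true) = A := by
        have hs := (Finset.mem_powerset.1 (Finset.mem_filter.1 hA).1)
        ext i
        simp only [ind, Finset.mem_filter, decide_eq_true_eq]
        exact ⟨fun h => h.2, fun h => ⟨hs h, h⟩⟩
      rw [this]
    · intro A _
      have : 0 ≤ 1 - t := by linarith
      positivity
  · intro A hA B hB hAB
    refine Set.disjoint_left.2 fun x hx hx' => hAB ?_
    have hs := (Finset.mem_powerset.1 (Finset.mem_filter.1 hA).1)
    have hs' := (Finset.mem_powerset.1 (Finset.mem_filter.1 hB).1)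
    have hh : ∀ i ∈ Finset.range M, (i ∈ A ↔ i ∈ B) := by
      intro i hi
      have := (hx i hi).symm.trans (hx' i hi)
      simpa [ind] using this
    ext i
    exact ⟨fun h => (hh i (hs h)).1 h, fun h => (hh i (hs' h)).2 h⟩
  · intro A _
    exact (isClopen_cyl _ _).isOpen.measurableSet

/-- reduction of `x ∈ ℤ[√3, 1/2]` modulo 3 -/
def Red (x : ℝ) (a b : ZMod 3) : Prop :=
  ∃ (k : ℕ) (A B : ℤ), 4 ^ k * x = A + B * √3 ∧ (A : ZMod 3) = a ∧ (B : ZMod 3) = b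

lemma four_pow (k : ℕ) : (4 : ZMod 3) ^ k = 1 := by
  have : (4 : ZMod 3) = 1 := by decide
  rw [this, one_pow]

lemma three_zero : (3 : ZMod 3) = 0 := by decide

lemma Red.unique {x : ℝ} {a b a' b' : ZMod 3} (h : Red x a b) (h' : Red x a' b') :
    a = a' ∧ b = b' := by
  obtain ⟨k, A, B, h, rfl, rfl⟩ := h
  obtain ⟨k', A', B', h', rfl, rfl⟩ := h'
  have irr : Irrational (√3) := by
    have := Nat.Prime.irrational_sqrt (p := 3) (by norm_num)
    simpa using this
  have e : ((4 ^ k' * A - 4 ^ k * A' : ℤ) : ℝ) + ((4 ^ k' * B - 4 ^ k * B' : ℤ) : ℝ) * √3 = 0 := by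
    push_cast
    linear_combination (4 : ℝ) ^ k * h' - (4 : ℝ) ^ k' * h
  have hB : (4 ^ k' * B - 4 ^ k * B' : ℤ) = 0 := by
    by_contra hne
    have : Irrational (((4 ^ k' * A - 4 ^ k * A' : ℤ) : ℝ) +
        ((4 ^ k' * B - 4 ^ k * B' : ℤ) : ℝ) * √3) := (irr.intCast_mul hne).intCast_add _
    rw [e] at this
    exact not_irrational_zero this
  have hA : (4 ^ k' * A - 4 ^ k * A' : ℤ) = 0 := by
    rw [hB] at e
    simp only [Int.cast_zero, zero_mul, add_zero] at e
    exact_mod_cast e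
  have hA' := congrArg (Int.cast : ℤ → ZMod 3) hA
  have hB' := congrArg (Int.cast : ℤ → ZMod 3) hB
  push_cast at hA' hB'
  rw [four_pow, four_pow, one_mul, one_mul, sub_eq_zero] at hA' hB'
  exact ⟨hA', hB'⟩

lemma Red.add {x y : ℝ} {a b a' b' : ZMod 3} (h : Red x a b) (h' : Red y a' b') :
    Red (x + y) (a + a') (b + b') := by
  obtain ⟨k, A, B, h, rfl, rfl⟩ := h
  obtain ⟨k', A', B', h', rfl, rfl⟩ := h'
  refine ⟨k + k', 4 ^ k' * A + 4 ^ k * A', 4 ^ k' * B + 4 ^ k * B', ?_, ?_, ?_⟩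
  · push_cast
    rw [pow_add]
    linear_combination (4 : ℝ) ^ k * h' + (4 : ℝ) ^ k' * h
  · push_cast; rw [four_pow, four_pow]; ring
  · push_cast; rw [four_pow, four_pow]; ring

lemma Red.mul {x y : ℝ} {a b a' b' : ZMod 3} (h : Red x a b) (h' : Red y a' b') :
    Red (x * y) (a * a') (a * b' + b * a') := by
  obtain ⟨k, A, B, h, rfl, rfl⟩ := h
  obtain ⟨k', A', B', h', rfl, rfl⟩ := h'
  refine ⟨k + k', A * A' + 3 * (B * B'), A * B' + B * A', ?_, ?_, ?_⟩
  · push_cast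
    have h3 : √3 * √3 = 3 := Real.mul_self_sqrt (by norm_num)
    have : (4 : ℝ) ^ (k + k') * (x * y) = (4 ^ k * x) * (4 ^ k' * y) := by rw [pow_add]; ring
    rw [this, h, h']
    linear_combination (B : ℝ) * B' * h3
  · push_cast; rw [three_zero]; ring
  · push_cast; ring

lemma red_zero : Red 0 0 0 := ⟨0, 0, 0, by simp, by simp, by simp⟩
lemma red_one : Red 1 1 0 := ⟨0, 1, 0, by simp, by simp, by simp⟩

lemma red_sum {ι : Type*} (T : Finset ι) (f : ι → ℝ) (a b : ι → ZMod 3)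
    (h : ∀ i ∈ T, Red (f i) (a i) (b i)) : Red (∑ i ∈ T, f i) (∑ i ∈ T, a i) (∑ i ∈ T, b i) := by
  classical
  induction T using Finset.induction_on with
  | empty => simpa using red_zero
  | insert i T hi ih =>
    rw [Finset.sum_insert hi, Finset.sum_insert hi, Finset.sum_insert hi]
    exact (h i (Finset.mem_insert_self _ _)).add
      (ih fun j hj => h j (Finset.mem_insert_of_mem hj))

lemma red_pow {x : ℝ} {b : ZMod 3} (h : Red x 1 b) (n : ℕ) : Red (x ^ n) 1 (n * b) := by
  induction n with
  | zero => simpa using red_one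
  | succ n ih =>
    rw [pow_succ]
    convert ih.mul h using 1
    · simp
    · push_cast; ring

/-- the reduction of a cylinder weight -/
lemma red_weight {t : ℝ} {c d : ZMod 3} (h : Red t 0 c) (h' : Red (1 - t) 1 d) (k l : ℕ) :
    Red (t ^ k * (1 - t) ^ l) (if k = 0 then 1 else 0)
      (if k = 0 then l * d else if k = 1 then c else 0) := by
  have hl := red_pow h' l
  match k with
  | 0 => simpa using hl
  | 1 => simpa using h.mul hl
  | k + 2 =>
    have h2 : Red (t ^ (k + 2)) 0 0 := by
      induction k with
      | zero => simpa [pow_two] using h.mul h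
      | succ k ih => simpa [pow_succ] using ih.mul h
    simpa using h2.mul hl

noncomputable def r0 : ℝ := (3 - √3) / 2
noncomputable def s0 : ℝ := √3 / 2

lemma red_r : Red r0 0 1 := ⟨1, 6, -2, by simp [r0]; ring, by decide, by decide⟩
lemma red_r' : Red (1 - r0) 1 2 := ⟨1, -2, 2, by simp [r0]; ring, by decide, by decide⟩
lemma red_s : Red s0 0 2 := ⟨1, 0, 2, by simp [s0]; ring, by decide, by decide⟩
lemma red_s' : Red (1 - s0) 1 1 := ⟨1, 4, -2, by simp [s0]; ring, by decide, by decide⟩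

lemma sqrt3_bounds : 1 < √3 ∧ √3 < 2 := by
  constructor
  · rw [Real.lt_sqrt] <;> norm_num
  · rw [Real.sqrt_lt'] <;> norm_num

lemma sqrt3_sq : √3 ^ 2 = 3 := Real.sq_sqrt (by norm_num)

lemma r0_mem : 0 ≤ r0 ∧ r0 ≤ 1 := by
  have := sqrt3_bounds
  constructor <;> unfold r0 <;> linarith
lemma s0_mem : 0 ≤ s0 ∧ s0 ≤ 1 := by
  have := sqrt3_bounds
  constructor <;> unfold s0 <;> linarith

lemma s_of_r : 2 * r0 * (1 - r0) + r0 ^ 2 = s0 := by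
  unfold r0 s0
  linear_combination (-1 / 4) * sqrt3_sq

lemma r_of_s : 2 * s0 * (1 - s0) ^ 3 + 5 * s0 ^ 2 * (1 - s0) ^ 2 + s0 ^ 4 = r0 := by
  unfold r0 s0
  have h3 : √3 ^ 3 = 3 * √3 := by rw [pow_succ, sqrt3_sq]
  have h4 : √3 ^ 4 = 9 := by
    have : √3 ^ 4 = (√3 ^ 2) ^ 2 := by ring
    rw [this, sqrt3_sq]; norm_num
  ring_nf
  rw [h3, h4, sqrt3_sq]
  ring

lemma not_homeo {μ ν : Measure (ℕ → Bool)} (hμ : IsBernoulli r0 μ) (hν : IsBernoulli s0 ν) :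
    ¬ ∃ h : (ℕ → Bool) ≃ₜ (ℕ → Bool), ν = μ.map h := by
  rintro ⟨h, hmap⟩
  let e0 : ℕ → Bool := fun i => decide (i = 0)
  -- all the small cylinders around `e0`
  have main : ∀ s : Finset ℕ, 0 ∈ s → ∃ l : ℕ, ν (h '' cyl s e0) =
      ENNReal.ofReal (r0 ^ 1 * (1 - r0) ^ l) := by
    intro s hs
    refine ⟨(s.filter fun i => e0 i = false).card, ?_⟩
    rw [hmap, Measure.map_apply h.continuous.measurable
      (h.isClosedMap _ (isClopen_cyl s e0).isClosed).measurableSet,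
      Set.preimage_image_eq _ h.injective]
    have h1 := hμ s e0
    change μ (cyl s e0) = _ at h1
    rw [h1]
    have : s.filter (fun i => e0 i = true) = {0} := by
      ext i
      simp only [e0, Finset.mem_filter, decide_eq_true_eq, Finset.mem_singleton]
      constructor
      · exact fun h => h.2
      · rintro rfl; exact ⟨hs, rfl⟩
    rw [this, Finset.card_singleton]
  have main2 : ∀ s : Finset ℕ, 0 ∈ s → ∃ (M : ℕ) (T : Finset (Finset ℕ)) (l : Finset ℕ → ℕ),
      (∀ A, A ∈ T ↔ A ⊆ Finset.range M ∧ (fun i => decide (i ∈ A)) ∈ h '' cyl s e0) ∧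
      (∑ A ∈ T, (if A.card = 0 then (1 : ZMod 3) else 0)) = 0 ∧
      (∑ A ∈ T, (if A.card = 0 then (l A : ZMod 3) * 1 else if A.card = 1 then 2 else 0)) = 1 := by
    intro s hs
    obtain ⟨l, hl⟩ := main s hs
    have hclopen : IsClopen (h '' cyl s e0) :=
      ⟨h.isClosedMap _ (isClopen_cyl s e0).isClosed, h.isOpenMap _ (isClopen_cyl s e0).isOpen⟩
    obtain ⟨M, T, l', hT, hval⟩ := clopen_value s0_mem.1 s0_mem.2 hν hclopen
    refine ⟨M, T, l', hT, ?_⟩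
    have hr := r0_mem
    have hs0 := s0_mem
    have hr' : 0 ≤ 1 - r0 := by linarith
    have hs' : 0 ≤ 1 - s0 := by linarith
    have hr1 := hr.1
    have hs1 := hs0.1
    rw [hval, ENNReal.ofReal_eq_ofReal_iff (by positivity) (by positivity)] at hl
    have R1 := red_sum T _ _ _ fun A _ => red_weight red_s red_s' A.card (l' A)
    have R2 := red_weight red_r red_r' 1 l
    rw [← hl] at R2
    have := R1.unique R2
    simpa using this
  by_cases hy : ∃ j, h e0 j = true
  · obtain ⟨j, hj⟩ := hy
    have hopen : IsOpen {x : ℕ → Bool | h x j = true} :=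
      (isOpen_discrete {true}).preimage ((continuous_apply j).comp h.continuous)
    obtain ⟨I, u, hu, hsub⟩ := isOpen_pi_iff.1 hopen e0 hj
    obtain ⟨M, T, l, hT, -, hb⟩ := main2 (insert 0 I) (Finset.mem_insert_self _ _)
    have hmem : ∀ A ∈ T, j ∈ A := by
      intro A hA
      obtain ⟨x, hx, hxA⟩ := ((hT A).1 hA).2
      have : x ∈ {x : ℕ → Bool | h x j = true} := hsub fun i hi => by
        rw [hx i (Finset.mem_insert_of_mem hi)]
        exact (hu i hi).2
      have h2 : h x j = true := this
      rw [hxA] at h2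
      simpa using h2
    have hterm : ∀ A ∈ T, (if A.card = 0 then (l A : ZMod 3) * 1 else if A.card = 1 then 2 else 0)
        = if A = {j} then 2 else 0 := by
      intro A hA
      have hjA := hmem A hA
      have hne : A.card ≠ 0 := fun h0 => by
        rw [Finset.card_eq_zero.1 h0] at hjA; simp at hjA
      rw [if_neg hne]
      congr 1
      rw [Finset.card_eq_one, eq_iff_iff]
      constructor
      · rintro ⟨a, rfl⟩
        rw [Finset.mem_singleton.1 hjA]
      · exact fun h => ⟨j, h⟩
    rw [Finset.sum_congr rfl hterm, Finset.sum_ite_eq'] at hb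
    split_ifs at hb
    · exact absurd hb (by decide)
    · exact absurd hb (by decide)
  · push Not at hy
    obtain ⟨M, T, l, hT, ha, -⟩ := main2 {0} (Finset.mem_singleton_self _)
    have h0T : (∅ : Finset ℕ) ∈ T := by
      rw [hT]
      refine ⟨Finset.empty_subset _, e0, fun i _ => rfl, ?_⟩
      funext i
      simpa using hy i
    simp only [Finset.card_eq_zero] at ha
    rw [Finset.sum_ite_eq', if_pos h0T] at ha
    exact absurd ha (by decide)

end BernoulliAux

open BernoulliAux

/-- there exist binomially equivalent `r, s ∈ [0,1]` (so that each
of `μ_r`, `μ_s` is a continuous image of the other) such that `μ_r` and `μ_s`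
are not homeomorphic. -/
theorem exists_binomially_equivalent_non_homeomorphic :
    ∃ r s : ℝ, r ∈ Set.Icc (0 : ℝ) 1 ∧ s ∈ Set.Icc (0 : ℝ) 1 ∧
      (∃ P : Polynomial ℤ, IsPartitionPolynomial P ∧ aeval r P = s) ∧
      (∃ Q : Polynomial ℤ, IsPartitionPolynomial Q ∧ aeval s Q = r) ∧
      ∀ μ ν : Measure (ℕ → Bool), IsBernoulli r μ → IsBernoulli s ν →
        ((∃ f : (ℕ → Bool) → (ℕ → Bool), Continuous f ∧ ν = μ.map f) ∧
         (∃ g : (ℕ → Bool) → (ℕ → Bool), Continuous g ∧ μ = ν.map g) ∧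
         ¬ ∃ h : (ℕ → Bool) ≃ₜ (ℕ → Bool), ν = μ.map h) := by
  refine ⟨r0, s0, r0_mem, s0_mem, ⟨_, ⟨2, fun i => if i = 1 then 2 else if i = 2 then 1 else 0,
    ?_, rfl⟩, ?_⟩, ⟨_, ⟨4, fun i => if i = 1 then 2 else if i = 2 then 5 else if i = 4 then 1 else 0,
    ?_, rfl⟩, ?_⟩, ?_⟩
  · intro i hi
    interval_cases i <;> decide
  · rw [← s_of_r]
    simp [Finset.sum_range_succ, map_ofNat]
  · intro i hi
    interval_cases i <;> decide
  · rw [← r_of_s]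
    simp [Finset.sum_range_succ, map_ofNat]
  · intro μ ν hμ hν
    refine ⟨?_, ?_, not_homeo hμ hν⟩
    · refine exists_map r0_mem.1 r0_mem.2 s0_mem.1 s0_mem.2 2 (fun w => w 0 || w 1) ?_ hμ hν
      let E : (Fin 2 → Bool) ≃ Bool × Bool :=
        { toFun := fun w => (w 0, w 1)
          invFun := fun p => ![p.1, p.2]
          left_inv := fun w => by funext i; fin_cases i <;> rfl
          right_inv := fun p => rfl }
      have hE : ∀ p, E.symm p = ![p.1, p.2] := fun _ => rfl
      rw [← E.symm.sum_comp, ← s_of_r]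
      simp [hE, Fintype.sum_prod_type, Fin.prod_univ_succ]
      ring
    · refine exists_map s0_mem.1 s0_mem.2 r0_mem.1 r0_mem.2 4
        (fun w => (w 0 || w 1) &&
          decide ((w 0).toNat + (w 1).toNat + (w 2).toNat + (w 3).toNat ≠ 3)) ?_ hν hμ
      let E : (Fin 4 → Bool) ≃ Bool × Bool × Bool × Bool :=
        { toFun := fun w => (w 0, w 1, w 2, w 3)
          invFun := fun p => ![p.1, p.2.1, p.2.2.1, p.2.2.2]
          left_inv := fun w => by funext i; fin_cases i <;> rfl
          right_inv := fun p => rfl }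
      have hE : ∀ p, E.symm p = ![p.1, p.2.1, p.2.2.1, p.2.2.2] := fun _ => rfl
      rw [← E.symm.sum_comp, ← r_of_s]
      simp [hE, Fintype.sum_prod_type, Fin.prod_univ_succ]
      ring
end
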